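/- Let a ≥ 1, i ≥ 0 and let d = a(a+1)/2. For every k ≥ d·i with k ≥ 1, the total number of Kronecker tableaux of shape (3k, k^a)/α and type (3k−ai, (k+i)^a)/α, summed over all partitions α of k with at most a+1 parts, equals the number of coloured partitions of k − d·i with parts in B_a. -/

import Mathlib

/-- Number of coloured partitions of `k` with parts in
`B_a = {1̄, 2, 2̄, …, a, ā, a+1}`: the barred colours have weights `1, …, a`
(indexed by `Fin a`, index `i` having weight `i+1`) and the unbarred colours have
weights `2, …, a+1` (indexed by `Fin a`, index `i` having weight `i+2`). -/
noncomputable def colouredB (a k : ℕ) : ℕ :=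
  Nat.card {p : (Fin a → ℕ) × (Fin a → ℕ) //
    (∑ i : Fin a, ((i : ℕ) + 1) * p.1 i) + (∑ i : Fin a, ((i : ℕ) + 2) * p.2 i) = k}

/-- The cells of the skew shape `λ/α`, with rows and columns indexed from `0`:
cell `(i, j)` belongs to `λ/α` iff `α i ≤ j < λ i`. -/
def skewCells (lam alpha : ℕ → ℕ) : Set (ℕ × ℕ) :=
  {p | alpha p.1 ≤ p.2 ∧ p.2 < lam p.1}

/-- The number of cells of `S` in which the filling `T` has entry `v`. -/
noncomputable def entryCount (T : ℕ × ℕ → ℕ) (S : Set (ℕ × ℕ)) (v : ℕ) : ℕ :=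
  Nat.card {p : ℕ × ℕ // p ∈ S ∧ T p = v}

/-- The set of cells giving an initial segment of the reverse reading word of a
filling of `λ/α` (rows read right to left, from the top row downwards): all cells in
rows `< r`, together with the cells in row `r` lying in columns `≥ c`. -/
def rrwPrefix (lam alpha : ℕ → ℕ) (r c : ℕ) : Set (ℕ × ℕ) :=
  {p | p ∈ skewCells lam alpha ∧ (p.1 < r ∨ (p.1 = r ∧ c ≤ p.2))}

/-- `T` is a Kronecker tableau of shape `λ/α` and type `ν/α` (all partitions indexed
from `0`, so `lam 0` is the first part, etc.; `T` is required to vanish outside the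
skew shape):
* `α ⊆ λ ∩ ν`;
* `T` is a semistandard filling: positive entries, weakly increasing along rows,
  strictly increasing down columns;
* the entry `v+1` occurs exactly `ν_{v+1} − α_{v+1}` times (type condition);
* every initial segment of the reverse reading word is an `α`-lattice permutation;
* the `α`-condition: `α₁ = α₂`, or `α₁ > α₂` and (the number of `1`'s in the second
  row equals `α₁ − α₂`, or the number of `2`'s in the first row equals `α₁ − α₂`). -/
def IsKroneckerTableau (lam nu alpha : ℕ → ℕ) (T : ℕ × ℕ → ℕ) : Prop :=
  (∀ i, alpha i ≤ lam i ∧ alpha i ≤ nu i) ∧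
  (∀ p, p ∉ skewCells lam alpha → T p = 0) ∧
  (∀ p ∈ skewCells lam alpha, 1 ≤ T p) ∧
  (∀ i j j', (i, j) ∈ skewCells lam alpha → (i, j') ∈ skewCells lam alpha → j ≤ j' →
    T (i, j) ≤ T (i, j')) ∧
  (∀ i i' j, (i, j) ∈ skewCells lam alpha → (i', j) ∈ skewCells lam alpha → i < i' →
    T (i, j) < T (i', j)) ∧
  (∀ v : ℕ, entryCount T (skewCells lam alpha) (v + 1) = nu v - alpha v) ∧
  (∀ r c v : ℕ,
    entryCount T (rrwPrefix lam alpha r c) (v + 2) + alpha (v + 1) ≤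
      entryCount T (rrwPrefix lam alpha r c) (v + 1) + alpha v) ∧
  (alpha 0 = alpha 1 ∨
    (alpha 1 < alpha 0 ∧
      (entryCount T {p | p ∈ skewCells lam alpha ∧ p.1 = 1} 1 = alpha 0 - alpha 1 ∨
        entryCount T {p | p ∈ skewCells lam alpha ∧ p.1 = 0} 2 = alpha 0 - alpha 1)))

/-- The partition `(c, k, k, …, k)` with `a` copies of `k`, as a function `ℕ → ℕ`
indexed from `0`. -/
def hookRect (c k a : ℕ) : ℕ → ℕ :=
  fun i => if i = 0 then c else if i < a + 1 then k else 0

/-! ### Basic facts on `entryCount` -/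

namespace KT

def rowS (lam alpha : ℕ → ℕ) (s : ℕ) : Set (ℕ × ℕ) :=
  {p | p ∈ skewCells lam alpha ∧ p.1 = s}

lemma entryCount_eq (T : ℕ × ℕ → ℕ) (S : Set (ℕ × ℕ)) (v : ℕ) :
    entryCount T S v = ({p | p ∈ S ∧ T p = v} : Set (ℕ × ℕ)).ncard := by
  unfold entryCount
  exact Nat.card_coe_set_eq _

lemma skew_finite (lam alpha : ℕ → ℕ) (M : ℕ) (h : ∀ n, M ≤ n → lam n = 0) :
    (skewCells lam alpha).Finite := by
  apply Set.Finite.subset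
    ((Finset.range M ×ˢ Finset.range (∑ s ∈ Finset.range M, lam s)).finite_toSet)
  rintro ⟨r, j⟩ ⟨h1, h2⟩
  simp only at h1 h2
  have hr : r < M := by
    by_contra hc
    rw [h r (by omega)] at h2
    omega
  have : lam r ≤ ∑ s ∈ Finset.range M, lam s :=
    Finset.single_le_sum (f := lam) (fun _ _ => Nat.zero_le _) (Finset.mem_range.2 hr)
  simp only [Finset.coe_product, Finset.coe_range, Set.mem_prod, Set.mem_Iio]
  omega

lemma entryCount_mono {T : ℕ × ℕ → ℕ} {S S' : Set (ℕ × ℕ)} {v : ℕ} (hf : S'.Finite)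
    (h : ∀ p ∈ S, T p = v → p ∈ S') : entryCount T S v ≤ entryCount T S' v := by
  rw [entryCount_eq, entryCount_eq]
  apply Set.ncard_le_ncard _ (hf.subset (fun p hp => hp.1))
  rintro p ⟨h1, h2⟩
  exact ⟨h p h1 h2, h2⟩

lemma entryCount_congr {T : ℕ × ℕ → ℕ} {S S' : Set (ℕ × ℕ)} {v : ℕ}
    (h : ∀ p, T p = v → (p ∈ S ↔ p ∈ S')) : entryCount T S v = entryCount T S' v := by
  rw [entryCount_eq, entryCount_eq]
  congr 1
  ext p
  constructor
  · rintro ⟨h1, h2⟩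
    exact ⟨(h p h2).1 h1, h2⟩
  · rintro ⟨h1, h2⟩
    exact ⟨(h p h2).2 h1, h2⟩

lemma entryCount_union {T : ℕ × ℕ → ℕ} {S S' : Set (ℕ × ℕ)} (v : ℕ) (hf : S.Finite)
    (hf' : S'.Finite) (hd : ∀ p ∈ S, p ∉ S') :
    entryCount T (S ∪ S') v = entryCount T S v + entryCount T S' v := by
  rw [entryCount_eq, entryCount_eq, entryCount_eq, ← Set.ncard_union_eq _
    (hf.subset (fun p hp => hp.1)) (hf'.subset (fun p hp => hp.1))]
  · congr 1
    ext p
    simp only [Set.mem_union, Set.mem_ofPred_eq]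
    tauto
  · rw [Set.disjoint_left]
    rintro p ⟨h1, _⟩ ⟨h2, _⟩
    exact hd p h1 h2

lemma entryCount_zero {T : ℕ × ℕ → ℕ} {S : Set (ℕ × ℕ)} {v : ℕ}
    (h : ∀ p ∈ S, T p ≠ v) : entryCount T S v = 0 := by
  rw [entryCount_eq]
  have : ({p | p ∈ S ∧ T p = v} : Set (ℕ × ℕ)) = ∅ := by
    ext p
    simp only [Set.mem_ofPred_eq, Set.mem_empty_iff_false, iff_false]
    rintro ⟨h1, h2⟩
    exact h p h1 h2
  rw [this, Set.ncard_empty]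

lemma entryCount_ne {T : ℕ × ℕ → ℕ} {S : Set (ℕ × ℕ)} {v : ℕ} (hf : S.Finite)
    (h0 : entryCount T S v = 0) : ∀ p ∈ S, T p ≠ v := by
  rw [entryCount_eq, Set.ncard_eq_zero (hf.subset (fun p hp => hp.1))] at h0
  intro p hp hv
  have : p ∈ ({p | p ∈ S ∧ T p = v} : Set (ℕ × ℕ)) := ⟨hp, hv⟩
  rw [h0] at this
  exact this

lemma entryCount_mem {T : ℕ × ℕ → ℕ} {S S' : Set (ℕ × ℕ)} {v : ℕ} (hf : S.Finite)
    (hs : S' ⊆ S) (h : entryCount T S v ≤ entryCount T S' v) :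
    ∀ p ∈ S, T p = v → p ∈ S' := by
  rw [entryCount_eq, entryCount_eq] at h
  have := Set.eq_of_subset_of_ncard_le (s := {p | p ∈ S' ∧ T p = v})
    (t := {p | p ∈ S ∧ T p = v}) (fun p hp => ⟨hs hp.1, hp.2⟩) h
    (hf.subset (fun p hp => hp.1))
  intro p hp hv
  have h2 : p ∈ ({p | p ∈ S ∧ T p = v} : Set (ℕ × ℕ)) := ⟨hp, hv⟩
  rw [← this] at h2
  exact h2.1

lemma entryCount_row {T : ℕ × ℕ → ℕ} {lam alpha : ℕ → ℕ} {s v l h : ℕ}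
    (H : ∀ j, (alpha s ≤ j ∧ j < lam s ∧ T (s, j) = v) ↔ (l ≤ j ∧ j < h)) :
    entryCount T (rowS lam alpha s) v = h - l := by
  rw [entryCount_eq]
  have : ({p | p ∈ rowS lam alpha s ∧ T p = v} : Set (ℕ × ℕ)) =
      ((Finset.Ico l h).image (fun j => (s, j)) : Finset (ℕ × ℕ)) := by
    ext ⟨r, j⟩
    simp only [Finset.coe_image, Finset.coe_Ico, Set.mem_image, Set.mem_Ico, Prod.mk.injEq,
      Set.mem_ofPred_eq, rowS, skewCells]
    constructor
    · rintro ⟨⟨⟨h1, h2⟩, rfl⟩, h3⟩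
      exact ⟨j, (H j).1 ⟨h1, h2, h3⟩, rfl, rfl⟩
    · rintro ⟨j, h1, rfl, rfl⟩
      obtain ⟨h2, h3, h4⟩ := (H j).2 h1
      exact ⟨⟨⟨h2, h3⟩, rfl⟩, h4⟩
  rw [this, Set.ncard_coe_finset, Finset.card_image_of_injective, Nat.card_Ico]
  intro x y hxy
  simpa using hxy

lemma entryCount_sum {T : ℕ × ℕ → ℕ} {lam alpha : ℕ → ℕ} (v : ℕ) (M : ℕ)
    (h : ∀ n, M ≤ n → lam n = 0) :
    entryCount T (skewCells lam alpha) v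
      = ∑ s ∈ Finset.range M, entryCount T (rowS lam alpha s) v := by
  have hf := skew_finite lam alpha M h
  have key : ∀ m, entryCount T {p | p ∈ skewCells lam alpha ∧ p.1 < m} v
      = ∑ s ∈ Finset.range m, entryCount T (rowS lam alpha s) v := by
    intro m
    induction m with
    | zero => exact entryCount_zero (fun p hp => absurd hp.2 (by omega))
    | succ m ih =>
      rw [Finset.sum_range_succ, ← ih, ← entryCount_union v (hf.subset (fun p hp => hp.1))
        (hf.subset (fun p hp => hp.1))]
      · apply entryCount_congr
        intro p _
        simp only [Set.mem_ofPred_eq, Set.mem_union, rowS]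
        constructor
        · rintro ⟨h1, h2⟩
          rcases Nat.lt_succ_iff_lt_or_eq.1 h2 with h3 | h3
          · exact Or.inl ⟨h1, h3⟩
          · exact Or.inr ⟨h1, h3⟩
        · rintro (⟨h1, h2⟩ | ⟨h1, h2⟩)
          · exact ⟨h1, by omega⟩
          · exact ⟨h1, by omega⟩
      · rintro p ⟨_, h1⟩ ⟨_, h2⟩
        omega
  rw [← key]
  apply entryCount_congr
  intro p _
  simp only [Set.mem_ofPred_eq]
  constructor
  · intro h1
    refine ⟨h1, ?_⟩
    by_contra hc
    have h2 := h1.2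
    rw [h p.1 (by omega)] at h2
    omega
  · exact fun h1 => h1.1

/-- threshold lemma for weakly increasing rows -/
lemma threshold (f : ℕ → ℕ) (A B v : ℕ) (hAB : A ≤ B)
    (hm : ∀ j j', A ≤ j → j ≤ j' → j' < B → f j ≤ f j') :
    ∃ c, A ≤ c ∧ c ≤ B ∧ ∀ j, A ≤ j → j < B → (c ≤ j ↔ v ≤ f j) := by
  classical
  have hex : ∃ c, A ≤ c ∧ (c = B ∨ (c < B ∧ v ≤ f c)) := ⟨B, hAB, Or.inl rfl⟩
  refine ⟨Nat.find hex, (Nat.find_spec hex).1, Nat.find_min' hex ⟨hAB, Or.inl rfl⟩, ?_⟩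
  intro j h1 h2
  constructor
  · intro h3
    rcases (Nat.find_spec hex).2 with h4 | h4
    · omega
    · exact h4.2.trans (hm _ _ (Nat.find_spec hex).1 h3 h2)
  · intro h3
    exact Nat.find_min' hex ⟨h1, Or.inr ⟨h2, h3⟩⟩

/-! ### The parametrised tableaux -/

def nuF (a i k : ℕ) : ℕ → ℕ :=
  fun t => if t = 0 then 3 * k - a * i else if t < a + 1 then k + i else 0

def EE (a i k : ℕ) (x : ℕ → ℕ) (u : ℕ) : ℕ := 3 * k - ∑ w ∈ Finset.Ico u a, (i + x w)

open Classical in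
noncomputable def Tab (a i k : ℕ) (al x : ℕ → ℕ) (p : ℕ × ℕ) : ℕ :=
  if p ∈ skewCells (hookRect (3 * k) k a) al then
    (if p.1 = 0 then 1 + ((Finset.range a).filter (fun u => EE a i k x u ≤ p.2)).card
      else if p.2 < al p.1 + x (p.1 - 1) then 1 else p.1 + 1)
  else 0

structure Good (a i k : ℕ) (al x : ℕ → ℕ) : Prop where
  van : ∀ n, a + 1 ≤ n → al n = 0
  first : al 0 = al 1 + i + x 0
  step : ∀ j, j < a → al (j + 1) + i + x j ≤ al j
  size : ∑ n ∈ Finset.range (a + 1), al n = k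

lemma hr0 (c k a : ℕ) : hookRect c k a 0 = c := by simp [hookRect]
lemma hr1 {c k a r : ℕ} (h : 1 ≤ r) (h' : r ≤ a) : hookRect c k a r = k := by
  unfold hookRect
  rw [if_neg (by omega), if_pos (by omega)]
lemma hr2 {c k a r : ℕ} (h' : a + 1 ≤ r) : hookRect c k a r = 0 := by
  unfold hookRect
  rw [if_neg (by omega), if_neg (by omega)]
lemma hrpos {c k a r j : ℕ} (h : j < hookRect c k a r) : r ≤ a := by
  by_contra hc
  rw [hr2 (by omega)] at h
  omega

section good
variable {a i k : ℕ} {al x : ℕ → ℕ}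

lemma Good.anti1 (g : Good a i k al x) (n : ℕ) : al (n + 1) ≤ al n := by
  by_cases h : n < a
  · have := g.step n h
    omega
  · rw [g.van (n + 1) (by omega)]
    omega

lemma Good.anti (g : Good a i k al x) {m n : ℕ} (h : m ≤ n) : al n ≤ al m :=
  antitone_nat_of_succ_le g.anti1 h

/-- `∑ (i + x) (j+1) ≤ k`. -/
lemma Good.sumle (g : Good a i k al x) : ∑ w ∈ Finset.range a, (w + 1) * (i + x w) ≤ k := by
  have h : ∀ m, m ≤ a → ∑ w ∈ Finset.range m, (w + 1) * (i + x w) + m * al m ≤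
      ∑ n ∈ Finset.range m, al n := by
    intro m
    induction m with
    | zero => simp
    | succ m ih =>
      intro hm
      have h1 := ih (by omega)
      have h2 := g.step m (by omega)
      rw [Finset.sum_range_succ, Finset.sum_range_succ]
      nlinarith
  have h1 := h a le_rfl
  have h2 := g.size
  rw [Finset.sum_range_succ] at h2
  omega

lemma Good.al0 (g : Good a i k al x) (n : ℕ) : al n ≤ k := by
  have h2 := g.size
  rw [Finset.sum_range_succ'] at h2
  have := g.anti (Nat.zero_le n)
  omega

lemma Good.sumle' (g : Good a i k al x) : ∑ w ∈ Finset.range a, (i + x w) ≤ k := by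
  refine le_trans (Finset.sum_le_sum ?_) g.sumle
  intro w _
  nlinarith [Nat.zero_le (w * (i + x w))]

lemma Good.sumIco (g : Good a i k al x) (u : ℕ) : ∑ w ∈ Finset.Ico u a, (i + x w) ≤ k := by
  refine le_trans (Finset.sum_le_sum_of_subset ?_) g.sumle'
  intro w hw
  simp only [Finset.mem_Ico, Finset.mem_range] at *
  exact hw.2

lemma Good.E_add (g : Good a i k al x) (u : ℕ) :
    EE a i k x u + ∑ w ∈ Finset.Ico u a, (i + x w) = 3 * k := by
  have := g.sumIco u
  unfold EE
  omega

lemma Good.E_succ (g : Good a i k al x) {u : ℕ} (h : u < a) :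
    EE a i k x u + (i + x u) = EE a i k x (u + 1) := by
  have h1 := g.E_add u
  have h2 := g.E_add (u + 1)
  rw [Finset.sum_eq_sum_Ico_succ_bot h] at h1
  omega

lemma E_mono {u v : ℕ} (h : u ≤ v) : EE a i k x u ≤ EE a i k x v := by
  unfold EE
  apply Nat.sub_le_sub_left
  apply Finset.sum_le_sum_of_subset
  exact Finset.Ico_subset_Ico_left h

lemma Good.E_ge (g : Good a i k al x) (u : ℕ) : 2 * k ≤ EE a i k x u := by
  have h1 := g.E_add u
  have := g.sumIco u
  omega

lemma Good.E_zero (g : Good a i k al x) (ha : 1 ≤ a) : k + i ≤ EE a i k x 0 := by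
  have h1 := g.E_ge 0
  have h2 : i + x 0 ≤ k := by
    refine le_trans ?_ g.sumle'
    exact Finset.single_le_sum (f := fun w => i + x w) (fun _ _ => Nat.zero_le _)
      (Finset.mem_range.2 (by omega))
  omega

lemma card_E (u j : ℕ) (hu : u < a) :
    (u + 1 ≤ ((Finset.range a).filter (fun w => EE a i k x w ≤ j)).card) ↔
      EE a i k x u ≤ j := by
  constructor
  · intro h
    by_contra hc
    have : ((Finset.range a).filter (fun w => EE a i k x w ≤ j)) ⊆ Finset.range u := by
      intro w hw
      simp only [Finset.mem_filter, Finset.mem_range] at *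
      by_contra hw2
      have := E_mono (a := a) (i := i) (k := k) (x := x) (u := u) (v := w) (by omega)
      omega
    have := Finset.card_le_card this
    rw [Finset.card_range] at this
    omega
  · intro h
    have : Finset.range (u + 1) ⊆ ((Finset.range a).filter (fun w => EE a i k x w ≤ j)) := by
      intro w hw
      simp only [Finset.mem_filter, Finset.mem_range] at *
      have := E_mono (a := a) (i := i) (k := k) (x := x) (u := w) (v := u) (by omega)
      omega
    have := Finset.card_le_card this
    rw [Finset.card_range] at this
    omega

lemma Tab_out {p : ℕ × ℕ} (h : p ∉ skewCells (hookRect (3 * k) k a) al) :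
    Tab a i k al x p = 0 := by
  unfold Tab
  rw [if_neg h]

lemma Tab_zero {j : ℕ} (h : (0, j) ∈ skewCells (hookRect (3 * k) k a) al) :
    Tab a i k al x (0, j) = 1 + ((Finset.range a).filter (fun u => EE a i k x u ≤ j)).card := by
  unfold Tab
  rw [if_pos h, if_pos rfl]

lemma Tab_row {r j : ℕ} (hr : 1 ≤ r) (h : (r, j) ∈ skewCells (hookRect (3 * k) k a) al) :
    Tab a i k al x (r, j) = if j < al r + x (r - 1) then 1 else r + 1 := by
  unfold Tab
  rw [if_pos h, if_neg (by simp only; omega)]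

/-- Row zero, values at least `u+2`. -/
lemma Tab_zero_ge {j u : ℕ} (hu : u < a) (h : (0, j) ∈ skewCells (hookRect (3 * k) k a) al) :
    u + 2 ≤ Tab a i k al x (0, j) ↔ EE a i k x u ≤ j := by
  rw [Tab_zero h, ← card_E u j hu]
  omega

lemma Tab_zero_le {j : ℕ} (h : (0, j) ∈ skewCells (hookRect (3 * k) k a) al) :
    Tab a i k al x (0, j) ≤ a + 1 := by
  rw [Tab_zero h]
  have := Finset.card_filter_le (Finset.range a) (fun u => EE a i k x u ≤ j)
  rw [Finset.card_range] at this
  omega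

lemma Good.row0_count (g : Good a i k al x) {u : ℕ} (hu : u < a) :
    entryCount (Tab a i k al x) (rowS (hookRect (3 * k) k a) al 0) (u + 2) = i + x u := by
  have hE := g.E_succ hu
  have hge := g.E_ge u
  have hal := g.al0 0
  have h3 : EE a i k x (u + 1) ≤ 3 * k := by unfold EE; omega
  rw [entryCount_row (l := EE a i k x u) (h := EE a i k x (u + 1))]
  · omega
  · intro j
    rw [hr0]
    have key : ∀ (h1 : al 0 ≤ j) (h2 : j < 3 * k),
        (Tab a i k al x (0, j) = u + 2 ↔ (EE a i k x u ≤ j ∧ j < EE a i k x (u + 1))) := by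
      intro h1 h2
      have hc : (0, j) ∈ skewCells (hookRect (3 * k) k a) al := ⟨h1, by rw [hr0]; exact h2⟩
      have e1 := Tab_zero_ge (i := i) (x := x) hu hc
      have e2 := Tab_zero_le (i := i) (x := x) hc
      by_cases hu' : u + 1 < a
      · have e3 := Tab_zero_ge (i := i) (x := x) hu' hc
        omega
      · have : u + 1 = a := by omega
        have e4 : EE a i k x (u + 1) = 3 * k := by
          unfold EE
          simp [this]
        omega
    constructor
    · rintro ⟨h1, h2, h3⟩
      exact (key h1 h2).1 h3
    · rintro ⟨h1, h2⟩
      exact ⟨by omega, by omega, (key (by omega) (by omega)).2 ⟨h1, h2⟩⟩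

lemma Good.row0_count1 (_g : Good a i k al x) (ha : 1 ≤ a) :
    entryCount (Tab a i k al x) (rowS (hookRect (3 * k) k a) al 0) 1 = EE a i k x 0 - al 0 := by
  have h3 : EE a i k x 0 ≤ 3 * k := by unfold EE; omega
  apply entryCount_row
  intro j
  rw [hr0]
  have key : ∀ (h1 : al 0 ≤ j) (h2 : j < 3 * k),
      (Tab a i k al x (0, j) = 1 ↔ (j < EE a i k x 0)) := by
    intro h1 h2
    have hc : (0, j) ∈ skewCells (hookRect (3 * k) k a) al := ⟨h1, by rw [hr0]; exact h2⟩
    have e1 := Tab_zero_ge (i := i) (x := x) (u := 0) (by omega) hc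
    have e2 := Tab_zero (i := i) (x := x) hc
    omega
  constructor
  · rintro ⟨h1, h2, h3⟩
    exact ⟨h1, (key h1 h2).1 h3⟩
  · rintro ⟨h1, h2⟩
    exact ⟨by omega, by omega, (key (by omega) (by omega)).2 h2⟩

lemma Good.alx (g : Good a i k al x) {u : ℕ} (hu : u < a) : al (u + 1) + x u ≤ k := by
  have := g.step u hu
  have := g.al0 u
  omega

lemma Good.row_count1 (g : Good a i k al x) {u : ℕ} (hu : u < a) :
    entryCount (Tab a i k al x) (rowS (hookRect (3 * k) k a) al (u + 1)) 1 = x u := by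
  have hx := g.alx hu
  rw [entryCount_row (l := al (u + 1)) (h := al (u + 1) + x u)]
  · omega
  · intro j
    rw [hr1 (by omega) (by omega)]
    have key : ∀ (h1 : al (u + 1) ≤ j) (h2 : j < k),
        (Tab a i k al x (u + 1, j) = 1 ↔ (j < al (u + 1) + x u)) := by
      intro h1 h2
      rw [Tab_row (by omega) ⟨h1, by rw [hr1 (by omega) (by omega)]; exact h2⟩]
      simp only [Nat.add_sub_cancel]
      split_ifs <;> omega
    constructor
    · rintro ⟨h1, h2, h3⟩
      exact ⟨h1, (key h1 h2).1 h3⟩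
    · rintro ⟨h1, h2⟩
      exact ⟨by omega, by omega, (key (by omega) (by omega)).2 h2⟩

lemma Good.row_count2 (g : Good a i k al x) {u : ℕ} (hu : u < a) :
    entryCount (Tab a i k al x) (rowS (hookRect (3 * k) k a) al (u + 1)) (u + 2)
      = k - (al (u + 1) + x u) := by
  have hx := g.alx hu
  apply entryCount_row
  intro j
  rw [hr1 (by omega) (by omega)]
  have key : ∀ (h1 : al (u + 1) ≤ j) (h2 : j < k),
      (Tab a i k al x (u + 1, j) = u + 2 ↔ (al (u + 1) + x u ≤ j)) := by
    intro h1 h2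
    rw [Tab_row (by omega) ⟨h1, by rw [hr1 (by omega) (by omega)]; exact h2⟩]
    simp only [Nat.add_sub_cancel]
    split_ifs <;> omega
  constructor
  · rintro ⟨h1, h2, h3⟩
    exact ⟨(key h1 h2).1 h3, h2⟩
  · rintro ⟨h1, h2⟩
    exact ⟨by omega, by omega, (key (by omega) (by omega)).2 h1⟩

lemma fin (a k : ℕ) (al : ℕ → ℕ) : (skewCells (hookRect (3 * k) k a) al).Finite :=
  skew_finite _ _ (a + 1) (fun _ h => hr2 h)

lemma fin_row (a k : ℕ) (al : ℕ → ℕ) (s : ℕ) : (rowS (hookRect (3 * k) k a) al s).Finite :=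
  (fin a k al).subset (fun _ h => h.1)

lemma Tab_val {r j v : ℕ} (hv : 1 ≤ v) (h : (r, j) ∈ skewCells (hookRect (3 * k) k a) al)
    (h2 : Tab a i k al x (r, j) = v + 1) : r = 0 ∨ r = v := by
  by_cases hr : r = 0
  · exact Or.inl hr
  · rw [Tab_row (by omega) h] at h2
    split_ifs at h2 <;> omega

/-- total number of entries `u+2` -/
lemma Good.total2 (g : Good a i k al x) {u : ℕ} (hu : u < a) :
    entryCount (Tab a i k al x) (skewCells (hookRect (3 * k) k a) al) (u + 2)
      = k + i - al (u + 1) := by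
  have hx := g.alx hu
  have : entryCount (Tab a i k al x) (skewCells (hookRect (3 * k) k a) al) (u + 2) =
    entryCount (Tab a i k al x) (rowS (hookRect (3 * k) k a) al 0 ∪
      rowS (hookRect (3 * k) k a) al (u + 1)) (u + 2) := by
    apply entryCount_congr
    rintro ⟨r, j⟩ hp
    constructor
    · intro hc
      rcases Tab_val (v := u + 1) (by omega) hc hp with h | h
      · exact Or.inl ⟨hc, h⟩
      · exact Or.inr ⟨hc, h⟩
    · rintro (h | h)
      · exact h.1
      · exact h.1
  rw [this, entryCount_union _ (fin_row a k al 0) (fin_row a k al _), g.row0_count hu,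
    g.row_count2 hu]
  · omega
  · rintro p ⟨_, h1⟩ ⟨_, h2⟩
    omega

lemma Good.total1 (g : Good a i k al x) (ha : 1 ≤ a) :
    entryCount (Tab a i k al x) (skewCells (hookRect (3 * k) k a) al) 1
      = 3 * k - a * i - al 0 := by
  rw [entryCount_sum 1 (a + 1) (fun _ h => hr2 h), Finset.sum_range_succ', g.row0_count1 ha,
    Finset.sum_congr rfl (fun u hu => g.row_count1 (Finset.mem_range.1 hu))]
  have h1 := g.E_add 0
  have h2 := g.E_ge 0
  have h3 := g.al0 0
  rw [← Finset.range_eq_Ico, Finset.sum_add_distrib, Finset.sum_const, Finset.card_range,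
    smul_eq_mul] at h1
  omega

lemma Tab_le {p : ℕ × ℕ} (h : p ∈ skewCells (hookRect (3 * k) k a) al) :
    Tab a i k al x p ≤ a + 1 := by
  obtain ⟨r, j⟩ := p
  by_cases hr : r = 0
  · subst hr
    exact Tab_zero_le h
  · rw [Tab_row (by omega) h]
    have := hrpos h.2
    split_ifs <;> simp only at * <;> omega

theorem Good.kron (g : Good a i k al x) (ha : 1 ≤ a) (hai : a * i ≤ k) :
    IsKroneckerTableau (hookRect (3 * k) k a) (nuF a i k) al (Tab a i k al x) := by
  refine ⟨?_, fun p hp => Tab_out hp, ?_, ?_, ?_, ?_, ?_, ?_⟩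
  · intro r
    have h1 := g.al0 r
    unfold hookRect nuF
    by_cases hr : r = 0
    · simp only [hr, if_true] at *
      omega
    · by_cases hr2 : r < a + 1
      · simp only [hr, hr2, if_true, if_false]
        omega
      · have := g.van r (by omega)
        omega
  · rintro ⟨r, j⟩ hp
    by_cases hr : r = 0
    · subst hr
      rw [Tab_zero hp]
      omega
    · rw [Tab_row (by omega) hp]
      split_ifs <;> omega
  · intro r j j' hp hp' hjj
    by_cases hr : r = 0
    · subst hr
      rw [Tab_zero hp, Tab_zero hp']
      apply Nat.add_le_add_left
      apply Finset.card_le_card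
      intro u
      simp only [Finset.mem_filter, Finset.mem_range]
      omega
    · rw [Tab_row (by omega) hp, Tab_row (by omega) hp']
      split_ifs <;> omega
  · intro r r' j hp hp' hrr
    have hr' := hrpos hp'.2
    simp only at hr'
    have hjk : j < k := by
      have := hp'.2
      simp only at this
      rwa [hr1 (by omega) (by omega)] at this
    have hs := g.step (r' - 1) (by omega)
    rw [Nat.sub_add_cancel (by omega)] at hs
    have han := g.anti (m := r) (n := r' - 1) (by omega)
    have hp1 := hp.1
    simp only at hp1
    rw [Tab_row (by omega) hp', if_neg (by omega)]
    by_cases hr : r = 0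
    · subst hr
      have e1 := Tab_zero_ge (i := i) (x := x) (u := 0) (by omega) hp
      have := g.E_ge 0
      omega
    · rw [Tab_row (by omega) hp]
      split_ifs <;> omega
  · intro v
    by_cases hv : v = 0
    · subst hv
      rw [g.total1 ha]
      simp [nuF]
    · obtain ⟨u, rfl⟩ : ∃ u, v = u + 1 := ⟨v - 1, by omega⟩
      by_cases hu : u < a
      · rw [g.total2 hu]
        simp [nuF, hu]
      · rw [entryCount_zero]
        · simp [nuF, hu]
        · intro p hp
          have := Tab_le (i := i) (x := x) hp
          omega
  · intro r c v
    have hsub : rrwPrefix (hookRect (3 * k) k a) al r c ⊆ skewCells (hookRect (3 * k) k a) al :=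
      fun p hp => hp.1
    by_cases hv : v < a
    swap
    · rw [entryCount_zero, g.van (v + 1) (by omega)]
      · omega
      · intro p hp
        have := Tab_le (i := i) (x := x) (hsub hp)
        omega
    have hstep := g.step v hv
    by_cases hr : r = 0 ∨ r ≤ v
    · have : entryCount (Tab a i k al x) (rrwPrefix (hookRect (3 * k) k a) al r c) (v + 2) ≤
          entryCount (Tab a i k al x) (rowS (hookRect (3 * k) k a) al 0) (v + 2) := by
        apply entryCount_mono (fin_row a k al 0)
        rintro ⟨s, j⟩ hp hT
        have h2 := hp.2
        simp only at h2
        rcases Tab_val (v := v + 1) (by omega) hp.1 hT with h | h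
        · exact ⟨hp.1, h⟩
        · exact ⟨hp.1, by simp only; omega⟩
      rw [g.row0_count hv] at this
      omega
    · have h1 : entryCount (Tab a i k al x) (rrwPrefix (hookRect (3 * k) k a) al r c) (v + 2) ≤
          entryCount (Tab a i k al x) (skewCells (hookRect (3 * k) k a) al) (v + 2) :=
        entryCount_mono (fin a k al) (fun p hp _ => hp.1)
      rw [g.total2 hv] at h1
      have h0 := g.al0 (v + 1)
      have h0' := g.al0 v
      by_cases hv0 : v = 0
      · subst hv0
        have h2 : entryCount (Tab a i k al x) (rowS (hookRect (3 * k) k a) al 0) 1 ≤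
            entryCount (Tab a i k al x) (rrwPrefix (hookRect (3 * k) k a) al r c) 1 := by
          apply entryCount_mono ((fin a k al).subset hsub)
          rintro p ⟨h3, h4⟩ _
          exact ⟨h3, Or.inl (by omega)⟩
        rw [g.row0_count1 ha] at h2
        have := g.E_zero ha
        simp only [Nat.zero_add] at *
        omega
      · obtain ⟨u, rfl⟩ : ∃ u, v = u + 1 := ⟨v - 1, by omega⟩
        have h2 : entryCount (Tab a i k al x) (skewCells (hookRect (3 * k) k a) al) (u + 2) ≤
            entryCount (Tab a i k al x) (rrwPrefix (hookRect (3 * k) k a) al r c) (u + 2) := by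
          apply entryCount_mono ((fin a k al).subset hsub)
          rintro ⟨s, j⟩ hp hT
          refine ⟨hp, Or.inl ?_⟩
          simp only
          rcases Tab_val (v := u + 1) (by omega) hp hT with h | h <;> omega
        rw [g.total2 (by omega)] at h2
        have e : entryCount (Tab a i k al x) (rrwPrefix (hookRect (3 * k) k a) al r c) (u + 1 + 1)
          = entryCount (Tab a i k al x) (rrwPrefix (hookRect (3 * k) k a) al r c) (u + 2) := rfl
        omega
  · have h1 := g.first
    have h2 := g.row0_count (u := 0) (by omega)
    by_cases h : al 0 = al 1
    · exact Or.inl h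
    · refine Or.inr ⟨by omega, Or.inr ?_⟩
      change entryCount (Tab a i k al x) (rowS (hookRect (3 * k) k a) al 0) (0 + 2) = _
      omega

end good

/-! ### Every Kronecker tableau is of the parametrised form -/

theorem extract {a i k : ℕ} {al : ℕ → ℕ} {T : ℕ × ℕ → ℕ} (ha : 1 ≤ a)
    (hanti : ∀ n, al (n + 1) ≤ al n) (hvan : ∀ n, a + 1 ≤ n → al n = 0)
    (hsize : ∑ n ∈ Finset.range (a + 1), al n = k)
    (hK : IsKroneckerTableau (hookRect (3 * k) k a) (nuF a i k) al T) :
    ∃ x : ℕ → ℕ, Good a i k al x ∧ T = Tab a i k al x := by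
  obtain ⟨hle, hout, hpos, hrow, hcol, htype, hlat, hkr⟩ := hK
  have hAnti : ∀ {m n : ℕ}, m ≤ n → al n ≤ al m := fun h => antitone_nat_of_succ_le hanti h
  have hfin := fin a k al
  have hlam := fun r => (hle r).1
  -- entries are at most `a + 1`
  have hmax : ∀ p ∈ skewCells (hookRect (3 * k) k a) al, T p ≤ a + 1 := by
    intro p hp
    by_contra hc
    obtain ⟨v, hv⟩ : ∃ v, T p = v + 1 := ⟨T p - 1, by omega⟩
    have h0 := htype v
    have : nuF a i k v = 0 := by
      unfold nuF
      rw [if_neg (by omega), if_neg (by omega)]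
    rw [this, Nat.zero_sub] at h0
    exact entryCount_ne hfin h0 p hp hv
  have hcell : ∀ r j, 1 ≤ r → r ≤ a → al r ≤ j → j < k →
      (r, j) ∈ skewCells (hookRect (3 * k) k a) al := by
    intro r j h1 h2 h3 h4
    exact ⟨h3, by simp only; rw [hr1 h1 h2]; exact h4⟩
  have hcellk : ∀ r j, 1 ≤ r → (r, j) ∈ skewCells (hookRect (3 * k) k a) al →
      r ≤ a ∧ al r ≤ j ∧ j < k := by
    intro r j h1 h2
    have h3 := hrpos h2.2
    have h4 := h2.2
    simp only at h3 h4
    rw [hr1 h1 h3] at h4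
    exact ⟨h3, h2.1, h4⟩
  -- entries in row `r ≥ 1` are at most `r + 1`
  have hrowmax : ∀ r j, 1 ≤ r → (r, j) ∈ skewCells (hookRect (3 * k) k a) al →
      T (r, j) ≤ r + 1 := by
    intro r j h1 h2
    obtain ⟨h3, h4, h5⟩ := hcellk r j h1 h2
    have key : ∀ m, r + m ≤ a → T (r, j) + m ≤ T (r + m, j) := by
      intro m
      induction m with
      | zero => intro _; simp
      | succ m ih =>
        intro hm
        have e1 := ih (by omega)
        have e2 := hcol (r + m) (r + (m + 1)) j
          (hcell _ _ (by omega) (by omega) ((hAnti (by omega)).trans h4) h5)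
          (hcell _ _ (by omega) (by omega) ((hAnti (by omega)).trans h4) h5) (by omega)
        omega
    have e := key (a - r) (by omega)
    have e2 := hmax (r + (a - r), j)
      (hcell _ _ (by omega) (by omega) ((hAnti (by omega)).trans h4) h5)
    omega
  -- thresholds
  have hth : ∀ s v, ∃ c, al s ≤ c ∧ c ≤ hookRect (3 * k) k a s ∧
      ∀ j, al s ≤ j → j < hookRect (3 * k) k a s → (c ≤ j ↔ v ≤ T (s, j)) := by
    intro s v
    apply threshold (fun j => T (s, j)) _ _ _ (hlam s)
    intro j j' h1 h2 h3
    exact hrow s j j' ⟨h1, lt_of_le_of_lt h2 h3⟩ ⟨h1.trans h2, h3⟩ h2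
  choose C hC1 hC2 hC3 using hth
  set n : ℕ → ℕ → ℕ := fun s v => entryCount T (rowS (hookRect (3 * k) k a) al s) v with hn
  have htot : ∀ u, 1 ≤ u → u ≤ a →
      entryCount T (skewCells (hookRect (3 * k) k a) al) (u + 1) + al u = k + i := by
    intro u h1 h2
    have e := htype u
    have e2 := (hle u).2
    have : nuF a i k u = k + i := by
      unfold nuF
      rw [if_neg (by omega), if_pos (by omega)]
    omega
  have hun : ∀ s v, 1 ≤ s → entryCount T (rowS (hookRect (3 * k) k a) al 0 ∪
      rowS (hookRect (3 * k) k a) al s) v = n 0 v + n s v := by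
    intro s v hs
    apply entryCount_union _ (fin_row a k al 0) (fin_row a k al s)
    rintro p ⟨_, h1⟩ ⟨_, h2⟩
    omega
  -- the quantity `n 0 (u+1) + n u (u+1) + al u` is weakly decreasing
  have hdec : ∀ u, 1 ≤ u → u + 1 ≤ a →
      n 0 (u + 2) + n (u + 1) (u + 2) + al (u + 1) ≤ n 0 (u + 1) + n u (u + 1) + al u := by
    intro u h1 h2
    have hl := hlat (u + 1) (C (u + 1) (u + 2)) u
    have e1 : n 0 (u + 2) + n (u + 1) (u + 2) ≤ entryCount T
        (rrwPrefix (hookRect (3 * k) k a) al (u + 1) (C (u + 1) (u + 2))) (u + 2) := by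
      rw [← hun (u + 1) (u + 2) (by omega)]
      apply entryCount_mono (hfin.subset (fun p hp => hp.1))
      rintro ⟨r, j⟩ (⟨hp, hr⟩ | ⟨hp, hr⟩) hT
      · exact ⟨hp, Or.inl (by omega)⟩
      · simp only at hr
        subst hr
        exact ⟨hp, Or.inr ⟨rfl, (hC3 _ _ j hp.1 hp.2).2 hT.ge⟩⟩
    have e2 : entryCount T
        (rrwPrefix (hookRect (3 * k) k a) al (u + 1) (C (u + 1) (u + 2))) (u + 1) ≤
        n 0 (u + 1) + n u (u + 1) := by
      rw [← hun u (u + 1) (by omega)]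
      apply entryCount_mono ((fin_row a k al 0).union (fin_row a k al u))
      rintro ⟨r, j⟩ ⟨hp, hr⟩ hT
      simp only at hr
      rcases hr with hr | ⟨hr, hj⟩
      · by_cases hr0 : r = 0
        · exact Or.inl ⟨hp, hr0⟩
        · have := hrowmax r j (by omega) hp
          exact Or.inr ⟨hp, by simp only; omega⟩
      · subst hr
        have := (hC3 _ _ j hp.1 hp.2).1 hj
        simp only at this
        omega
    omega
  have hD : ∀ m u, 1 ≤ u → u + m = a → n 0 (u + 1) + n u (u + 1) + al u = k + i := by
    have hup : ∀ u, 1 ≤ u → u ≤ a → n 0 (u + 1) + n u (u + 1) + al u ≤ k + i := by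
      intro u h1 h2
      rw [← htot u h1 h2, ← hun u (u + 1) h1]
      apply Nat.add_le_add_right
      apply entryCount_mono hfin
      rintro p (h | h) _
      · exact h.1
      · exact h.1
    intro m
    induction m with
    | zero =>
      intro u h1 h2
      apply le_antisymm (hup u h1 (by omega))
      rw [← htot u h1 (by omega), ← hun u (u + 1) h1]
      apply Nat.add_le_add_right
      apply entryCount_mono ((fin_row a k al 0).union (fin_row a k al u))
      rintro ⟨r, j⟩ hp hT
      by_cases hr0 : r = 0
      · exact Or.inl ⟨hp, hr0⟩
      · have := hrowmax r j (by omega) hp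
        have := hrpos hp.2
        exact Or.inr ⟨hp, by simp only at *; omega⟩
    | succ m ih =>
      intro u h1 h2
      have e1 := hup u h1 (by omega)
      have e2 := ih (u + 1) (by omega) (by omega)
      have e3 := hdec u h1 (by omega)
      have e4 : n 0 (u + 1 + 1) = n 0 (u + 2) := rfl
      have e5 : n (u + 1) (u + 1 + 1) = n (u + 1) (u + 2) := rfl
      omega
  have hD' : ∀ u, 1 ≤ u → u ≤ a → n 0 (u + 1) + n u (u + 1) + al u = k + i :=
    fun u h1 h2 => hD (a - u) u h1 (by omega)
  -- rows `r ≥ 1` contain only `1` and `r + 1`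
  have htwo : ∀ r j, 1 ≤ r → (r, j) ∈ skewCells (hookRect (3 * k) k a) al →
      T (r, j) = 1 ∨ T (r, j) = r + 1 := by
    intro r j h1 h2
    by_contra hc
    have hm := hrowmax r j h1 h2
    have hp := hpos _ h2
    have hra := (hcellk r j h1 h2).1
    obtain ⟨u, hu⟩ : ∃ u, T (r, j) = u + 1 := ⟨T (r, j) - 1, by omega⟩
    have e1 := hD' u (by omega) (by omega)
    have e2 := htot u (by omega) (by omega)
    have e3 := hun u (u + 1) (by omega)
    have := entryCount_mem (T := T) (v := u + 1) (S' := rowS (hookRect (3 * k) k a) al 0 ∪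
      rowS (hookRect (3 * k) k a) al u) hfin (by
        rintro p (h | h)
        · exact h.1
        · exact h.1) (by omega) (r, j) h2 hu
    rcases this with h | h
    · have := h.2
      simp only at this
      omega
    · have := h.2
      simp only at this
      omega
  -- the parameters
  set x : ℕ → ℕ := fun u => C (u + 1) 2 - al (u + 1) with hx
  have hxC : ∀ u, C (u + 1) 2 = al (u + 1) + x u := by
    intro u
    have := hC1 (u + 1) 2
    simp only [hx]
    omega
  have hval : ∀ u j, u < a → al (u + 1) ≤ j → j < k →
      T (u + 1, j) = if j < al (u + 1) + x u then 1 else u + 2 := by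
    intro u j hu h1 h2
    have hc := hcell (u + 1) j (by omega) (by omega) h1 h2
    have e := hC3 (u + 1) 2 j hc.1 hc.2
    rw [hxC] at e
    have e2 := htwo (u + 1) j (by omega) hc
    split_ifs <;> omega
  have hxk : ∀ u, u < a → al (u + 1) + x u ≤ k := by
    intro u hu
    have := hC2 (u + 1) 2
    rw [hr1 (by omega) (by omega), hxC] at this
    exact this
  have hn1 : ∀ u, u < a → n (u + 1) 1 = x u := by
    intro u hu
    have hk := hxk u hu
    simp only [hn]
    rw [entryCount_row (l := al (u + 1)) (h := al (u + 1) + x u)]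
    · omega
    · intro j
      rw [hr1 (by omega) (by omega)]
      constructor
      · rintro ⟨h1, h2, h3⟩
        rw [hval u j hu h1 h2] at h3
        split_ifs at h3 <;> omega
      · rintro ⟨h1, h2⟩
        refine ⟨h1, by omega, ?_⟩
        rw [hval u j hu h1 (by omega), if_pos h2]
  have hn2 : ∀ u, u < a → n (u + 1) (u + 2) = k - (al (u + 1) + x u) := by
    intro u hu
    have hk := hxk u hu
    apply entryCount_row
    intro j
    rw [hr1 (by omega) (by omega)]
    constructor
    · rintro ⟨h1, h2, h3⟩
      rw [hval u j hu h1 h2] at h3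
      split_ifs at h3 <;> omega
    · rintro ⟨h1, h2⟩
      refine ⟨by omega, by omega, ?_⟩
      rw [hval u j hu (by omega) (by omega), if_neg (by omega)]
  have hn0 : ∀ u, u < a → n 0 (u + 2) = i + x u := by
    intro u hu
    have e1 := hD' (u + 1) (by omega) (by omega)
    have e2 := hn2 u hu
    have e3 := hxk u hu
    have e4 : n 0 (u + 1 + 1) = n 0 (u + 2) := rfl
    have e5 : n (u + 1) (u + 1 + 1) = n (u + 1) (u + 2) := rfl
    omega
  -- row zero lattice condition
  have hstep : ∀ u, u < a → al (u + 1) + i + x u ≤ al u := by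
    intro u hu
    have hl := hlat 0 (C 0 (u + 2)) u
    have e1 : n 0 (u + 2) ≤ entryCount T
        (rrwPrefix (hookRect (3 * k) k a) al 0 (C 0 (u + 2))) (u + 2) := by
      apply entryCount_mono (hfin.subset (fun p hp => hp.1))
      rintro ⟨r, j⟩ ⟨hp, hr⟩ hT
      simp only at hr
      subst hr
      exact ⟨hp, Or.inr ⟨rfl, (hC3 _ _ j hp.1 hp.2).2 hT.ge⟩⟩
    have e2 : entryCount T
        (rrwPrefix (hookRect (3 * k) k a) al 0 (C 0 (u + 2))) (u + 1) = 0 := by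
      apply entryCount_zero
      rintro ⟨r, j⟩ ⟨hp, hr⟩ hT
      simp only at hr
      rcases hr with hr | ⟨hr, hj⟩
      · omega
      · subst hr
        have := (hC3 _ _ j hp.1 hp.2).1 hj
        simp only at this
        omega
    have := hn0 u hu
    omega
  have hfirst : al 0 = al 1 + i + x 0 := by
    have e1 := hstep 0 (by omega)
    have e2 := hn0 0 (by omega)
    have e3 := hn1 0 (by omega)
    simp only [Nat.zero_add] at e1 e2 e3
    rcases hkr with h | ⟨_, h | h⟩
    · omega
    · change n 1 1 = _ at h
      omega
    · change n 0 2 = _ at h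
      omega
  have g : Good a i k al x := ⟨hvan, hfirst, hstep, hsize⟩
  -- row zero
  have hC0 : ∀ v, C 0 v ≤ C 0 (v + 1) := by
    intro v
    by_contra hc
    have h1 := hC1 0 (v + 1)
    have h2 := hC2 0 v
    have e1 := hC3 0 v (C 0 (v + 1)) h1 (by omega)
    have e2 := hC3 0 (v + 1) (C 0 (v + 1)) h1 (by omega)
    omega
  have hnC : ∀ v, n 0 v = C 0 (v + 1) - C 0 v := by
    intro v
    apply entryCount_row
    intro j
    have h1 := hC1 0 v
    have h2 := hC2 0 (v + 1)
    constructor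
    · rintro ⟨h3, h4, h5⟩
      have e1 := hC3 0 v j h3 h4
      have e2 := hC3 0 (v + 1) j h3 h4
      omega
    · rintro ⟨h3, h4⟩
      have e1 := hC3 0 v j (by omega) (by omega)
      have e2 := hC3 0 (v + 1) j (by omega) (by omega)
      omega
  have hClast : C 0 (a + 2) = 3 * k := by
    have h1 := hC1 0 (a + 2)
    have h2 := hC2 0 (a + 2)
    by_contra hc
    have h3 : C 0 (a + 2) < hookRect (3 * k) k a 0 := by
      rw [hr0] at *
      omega
    have e1 := hC3 0 (a + 2) _ h1 h3
    have e2 := hmax (0, C 0 (a + 2)) ⟨h1, h3⟩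
    omega
  have hCE : ∀ m u, u + m = a → C 0 (u + 2) = EE a i k x u := by
    intro m
    induction m with
    | zero =>
      intro u hu
      have : u = a := by omega
      subst this
      rw [hClast]
      simp [EE]
    | succ m ih =>
      intro u hu
      have e1 := ih (u + 1) (by omega)
      have e2 := g.E_succ (u := u) (by omega)
      have e3 := hn0 u (by omega)
      have e4 := hnC (u + 2)
      have e5 := hC0 (u + 2)
      have e6 : C 0 (u + 1 + 2) = C 0 (u + 2 + 1) := rfl
      omega
  refine ⟨x, g, ?_⟩
  funext ⟨r, j⟩
  by_cases hp : (r, j) ∈ skewCells (hookRect (3 * k) k a) al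
  · by_cases hr : r = 0
    · subst hr
      have key : ∀ u, u < a → (u + 2 ≤ T (0, j) ↔ u + 2 ≤ Tab a i k al x (0, j)) := by
        intro u hu
        rw [Tab_zero_ge hu hp, ← hCE (a - u) u (by omega)]
        exact (hC3 0 (u + 2) j hp.1 hp.2).symm
      have b1 := hmax _ hp
      have b2 := hpos _ hp
      have b3 := Tab_zero_le (i := i) (x := x) hp
      have b4 := Tab_zero (i := i) (x := x) hp
      rcases lt_trichotomy (T (0, j)) (Tab a i k al x (0, j)) with h | h | h
      · have := key (Tab a i k al x (0, j) - 2) (by omega)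
        omega
      · exact h
      · have := key (T (0, j) - 2) (by omega)
        omega
    · obtain ⟨u, rfl⟩ : ∃ u, r = u + 1 := ⟨r - 1, by omega⟩
      obtain ⟨h1, h2, h3⟩ := hcellk (u + 1) j (by omega) hp
      rw [hval u j (by omega) h2 h3, Tab_row (by omega) hp]
      rfl
  · rw [hout _ hp, Tab_out hp]

/-! ### The bijection with coloured partitions -/

/-- Zero extension. -/
def ext0 {a : ℕ} (f : Fin a → ℕ) (n : ℕ) : ℕ := if h : n < a then f ⟨n, h⟩ else 0

lemma ext0_lt {a : ℕ} (f : Fin a → ℕ) {n : ℕ} (h : n < a) : ext0 f n = f ⟨n, h⟩ := by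
  simp [ext0, h]

def gap {a : ℕ} (i : ℕ) (p : (Fin a → ℕ) × (Fin a → ℕ)) (j : ℕ) : ℕ :=
  (if j < a then i + ext0 p.1 j else 0) + (if 1 ≤ j then ext0 p.2 (j - 1) else 0)

def alF {a : ℕ} (i : ℕ) (p : (Fin a → ℕ) × (Fin a → ℕ)) (n : ℕ) : ℕ :=
  ∑ j ∈ Finset.Ico n (a + 1), gap i p j

lemma alF_van {a i : ℕ} (p : (Fin a → ℕ) × (Fin a → ℕ)) {n : ℕ} (h : a + 1 ≤ n) :
    alF i p n = 0 := by
  unfold alF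
  rw [Finset.Ico_eq_empty (by omega), Finset.sum_empty]

lemma alF_succ {a i : ℕ} (p : (Fin a → ℕ) × (Fin a → ℕ)) {n : ℕ} (h : n < a + 1) :
    alF i p n = gap i p n + alF i p (n + 1) := by
  unfold alF
  rw [Finset.sum_eq_sum_Ico_succ_bot h]

lemma sum_al (al gp : ℕ → ℕ) (M : ℕ) (h0 : al M = 0)
    (h : ∀ n, n < M → al n = gp n + al (n + 1)) :
    ∑ n ∈ Finset.range M, al n = ∑ n ∈ Finset.range M, (n + 1) * gp n := by
  have key : ∀ m, m ≤ M → ∑ n ∈ Finset.range m, al n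
      = ∑ n ∈ Finset.range m, (n + 1) * gp n + m * al m := by
    intro m
    induction m with
    | zero => simp
    | succ m ih =>
      intro hm
      rw [Finset.sum_range_succ, Finset.sum_range_succ, ih (by omega), h m (by omega)]
      ring
  rw [key M le_rfl, h0]
  simp

lemma sum_gap {a i : ℕ} (p : (Fin a → ℕ) × (Fin a → ℕ)) :
    ∑ n ∈ Finset.range (a + 1), (n + 1) * gap i p n =
      a * (a + 1) / 2 * i + ((∑ j : Fin a, ((j : ℕ) + 1) * p.1 j) +
        (∑ j : Fin a, ((j : ℕ) + 2) * p.2 j)) := by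
  have h1 : ∑ j : Fin a, ((j : ℕ) + 1) * p.1 j
      = ∑ n ∈ Finset.range a, (n + 1) * ext0 p.1 n := by
    rw [Finset.sum_range]
    exact Finset.sum_congr rfl (fun j _ => by rw [ext0_lt p.1 j.2])
  have h2 : ∑ j : Fin a, ((j : ℕ) + 2) * p.2 j
      = ∑ n ∈ Finset.range a, (n + 2) * ext0 p.2 n := by
    rw [Finset.sum_range]
    exact Finset.sum_congr rfl (fun j _ => by rw [ext0_lt p.2 j.2])
  have h3 : a * (a + 1) / 2 = ∑ n ∈ Finset.range a, (n + 1) := by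
    have := Finset.sum_range_id (a + 1)
    rw [Finset.sum_range_succ'] at this
    rw [Nat.add_sub_cancel, Nat.mul_comm] at this
    omega
  have h4 : ∑ n ∈ Finset.range (a + 1), (n + 1) * gap i p n =
      ∑ n ∈ Finset.range (a + 1), (n + 1) * (if n < a then i + ext0 p.1 n else 0) +
      ∑ n ∈ Finset.range (a + 1), (n + 1) * (if 1 ≤ n then ext0 p.2 (n - 1) else 0) := by
    rw [← Finset.sum_add_distrib]
    exact Finset.sum_congr rfl (fun n _ => by unfold gap; ring)
  have h5 : ∑ n ∈ Finset.range (a + 1), (n + 1) * (if n < a then i + ext0 p.1 n else 0) =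
      ∑ n ∈ Finset.range a, (n + 1) * (i + ext0 p.1 n) := by
    rw [Finset.sum_range_succ, if_neg (by omega), Nat.mul_zero, Nat.add_zero]
    exact Finset.sum_congr rfl (fun n hn => by rw [if_pos (Finset.mem_range.1 hn)])
  have h6 : ∑ n ∈ Finset.range (a + 1), (n + 1) * (if 1 ≤ n then ext0 p.2 (n - 1) else 0) =
      ∑ n ∈ Finset.range a, (n + 2) * ext0 p.2 n := by
    rw [Finset.sum_range_succ', if_neg (by omega), Nat.mul_zero, Nat.add_zero]
    exact Finset.sum_congr rfl (fun n hn => by rw [if_pos (by omega), Nat.add_sub_cancel])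
  rw [h4, h5, h6, h1, h2, h3, Finset.sum_mul, ← Nat.add_assoc]
  congr 1
  rw [← Finset.sum_add_distrib]
  exact Finset.sum_congr rfl (fun n _ => by ring)

lemma good_alF {a i k : ℕ} (ha : 1 ≤ a) (hk : a * (a + 1) / 2 * i ≤ k)
    (p : (Fin a → ℕ) × (Fin a → ℕ))
    (hp : (∑ j : Fin a, ((j : ℕ) + 1) * p.1 j) + (∑ j : Fin a, ((j : ℕ) + 2) * p.2 j)
      = k - a * (a + 1) / 2 * i) :
    Good a i k (alF i p) (ext0 p.1) := by
  refine ⟨fun n hn => alF_van p hn, ?_, ?_, ?_⟩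
  · rw [alF_succ p (by omega)]
    simp only [gap]
    rw [if_pos (by omega), if_neg (by omega)]
    ring_nf
  · intro j hj
    rw [alF_succ p (n := j) (by omega)]
    simp only [gap]
    rw [if_pos hj]
    omega
  · rw [sum_al _ (gap i p) (a + 1) (alF_van p le_rfl) (fun n hn => alF_succ p hn), sum_gap, hp]
    omega

lemma exists_p {a i k : ℕ} {al x : ℕ → ℕ} (ha : 1 ≤ a)
    (hk : a * (a + 1) / 2 * i ≤ k) (g : Good a i k al x) :
    ∃ p : (Fin a → ℕ) × (Fin a → ℕ),
      (∑ j : Fin a, ((j : ℕ) + 1) * p.1 j) + (∑ j : Fin a, ((j : ℕ) + 2) * p.2 j)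
        = k - a * (a + 1) / 2 * i ∧ al = alF i p ∧ (∀ u, u < a → ext0 p.1 u = x u) := by
  let p : (Fin a → ℕ) × (Fin a → ℕ) :=
    (fun j => x j, fun j => al (j + 1) - al (j + 2) - (if (j : ℕ) + 1 < a then i + x (j + 1) else 0))
  have hp1 : ∀ u, u < a → ext0 p.1 u = x u := fun u hu => by rw [ext0_lt _ hu]
  have hp2 : ∀ u, u < a → ext0 p.2 u
      = al (u + 1) - al (u + 2) - (if u + 1 < a then i + x (u + 1) else 0) :=
    fun u hu => by rw [ext0_lt _ hu]
  have hgap : ∀ n, n < a + 1 → al n = gap i p n + al (n + 1) := by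
    intro n hn
    unfold gap
    by_cases h0 : n = 0
    · subst h0
      rw [if_pos (by omega), if_neg (by omega), hp1 0 (by omega)]
      have := g.first
      simp only [Nat.zero_add]
      omega
    · obtain ⟨u, rfl⟩ : ∃ u, n = u + 1 := ⟨n - 1, by omega⟩
      rw [if_pos (show 1 ≤ u + 1 by omega), Nat.add_sub_cancel, hp2 u (by omega)]
      have e : al (u + 1 + 1) = al (u + 2) := rfl
      by_cases hu : u + 1 < a
      · rw [if_pos hu, if_pos hu, hp1 _ hu]
        have := g.step (u + 1) hu
        omega
      · rw [if_neg hu, if_neg hu]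
        have := g.anti1 (u + 1)
        omega
  have hal : al = alF i p := by
    have key : ∀ m n, n + m = a + 1 → al n = alF i p n := by
      intro m
      induction m with
      | zero =>
        intro n hn
        rw [alF_van p (by omega), g.van n (by omega)]
      | succ m ih =>
        intro n hn
        rw [hgap n (by omega), alF_succ p (by omega), ih (n + 1) (by omega)]
    funext n
    by_cases hn : n < a + 1
    · exact key (a + 1 - n) n (by omega)
    · rw [alF_van p (by omega), g.van n (by omega)]
  refine ⟨p, ?_, hal, hp1⟩
  have h1 := g.size
  rw [sum_al _ (gap i p) (a + 1) (g.van _ le_rfl) hgap, sum_gap] at h1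
  omega

lemma Tab_congr {a i k : ℕ} {al x x' : ℕ → ℕ} (h : ∀ u, u < a → x u = x' u) :
    Tab a i k al x = Tab a i k al x' := by
  have hE : ∀ u, EE a i k x u = EE a i k x' u := by
    intro u
    unfold EE
    congr 1
    apply Finset.sum_congr rfl
    intro w hw
    rw [h w (Finset.mem_Ico.1 hw).2]
  funext ⟨r, j⟩
  by_cases hp : (r, j) ∈ skewCells (hookRect (3 * k) k a) al
  · by_cases hr : r = 0
    · subst hr
      rw [Tab_zero hp, Tab_zero hp]
      simp only [hE]
    · have := hrpos hp.2
      simp only at this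
      rw [Tab_row (by omega) hp, Tab_row (by omega) hp, h (r - 1) (by omega)]
  · rw [Tab_out hp, Tab_out hp]

lemma alF_inj {a i : ℕ} {p q : (Fin a → ℕ) × (Fin a → ℕ)} (h1 : p.1 = q.1)
    (h : alF i p = alF i q) : p = q := by
  apply Prod.ext h1
  funext ⟨u, hu⟩
  have e1 := alF_succ (i := i) p (n := u + 1) (by omega)
  have e2 := alF_succ (i := i) q (n := u + 1) (by omega)
  rw [h] at e1
  have e3 : gap i p (u + 1) = gap i q (u + 1) := by omega
  unfold gap at e3
  rw [h1, if_pos (show 1 ≤ u + 1 by omega), if_pos (show 1 ≤ u + 1 by omega),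
    Nat.add_sub_cancel, ext0_lt _ hu, ext0_lt _ hu] at e3
  omega

end KT

/-- For `k ≥ d·i` with `d = a(a+1)/2`, the total number of Kronecker tableaux of
shape `(3k, k^a)/α` and type `(3k−ai, (k+i)^a)/α`, summed over all partitions
`α ⊢ k` with at most `a+1` parts, equals the number of coloured partitions of
`k − d·i` with parts in `B_a`. -/
theorem kroneckerTableaux_family2_count (a i k : ℕ) (ha : 1 ≤ a) (hk1 : 1 ≤ k)
    (hk : a * (a + 1) / 2 * i ≤ k) :
    Nat.card {x : (ℕ → ℕ) × (ℕ × ℕ → ℕ) //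
      (∀ n, x.1 (n + 1) ≤ x.1 n) ∧
      (∀ n, a + 1 ≤ n → x.1 n = 0) ∧
      (∑ n ∈ Finset.range (a + 1), x.1 n) = k ∧
      IsKroneckerTableau (hookRect (3 * k) k a)
        (fun t => if t = 0 then 3 * k - a * i else if t < a + 1 then k + i else 0)
        x.1 x.2} =
    colouredB a (k - a * (a + 1) / 2 * i) := by
  have hai : a * i ≤ k := by
    refine le_trans (Nat.mul_le_mul_right i ?_) hk
    rw [Nat.le_div_iff_mul_le (by omega)]
    exact Nat.mul_le_mul_left a (by omega)
  symm
  unfold colouredB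
  refine Nat.card_congr (Equiv.ofBijective (fun p =>
    ⟨(KT.alF i p.1, KT.Tab a i k (KT.alF i p.1) (KT.ext0 p.1.1)), ?_⟩) ⟨?_, ?_⟩)
  · have g := KT.good_alF ha hk p.1 p.2
    exact ⟨g.anti1, g.van, g.size, g.kron ha hai⟩
  · rintro ⟨p, hp⟩ ⟨q, hq⟩ h
    have g := KT.good_alF ha hk p hp
    have g' := KT.good_alF ha hk q hq
    simp only [Subtype.mk.injEq, Prod.mk.injEq] at h
    obtain ⟨h1, h2⟩ := h
    rw [← h1] at h2 g'
    apply Subtype.ext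
    apply KT.alF_inj _ h1
    funext ⟨u, hu⟩
    have e1 := g.row_count1 hu
    have e2 := g'.row_count1 hu
    rw [← h2, e1, KT.ext0_lt _ hu, KT.ext0_lt _ hu] at e2
    exact e2
  · rintro ⟨⟨al, T⟩, h1, h2, h3, h4⟩
    obtain ⟨x, g, rfl⟩ := KT.extract (al := al) (T := T) ha h1 h2 h3 h4
    obtain ⟨p, hp, rfl, hx⟩ := KT.exists_p ha hk g
    refine ⟨⟨p, hp⟩, ?_⟩
    apply Subtype.ext
    exact Prod.ext rfl (KT.Tab_congr hx)
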